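/- For all integers 1 ≤ s < t ≤ T, every bounded measurable function h : X → ℝ with φ_{s|T}(h) = 0, and every x' ∈ X, | φ_{s,t-1|t-1}((x_s, x_{t-1}) ↦ h(x_s)·q(x_{t-1}, x')) · L_{t,T}(x', 1) / φ_{t|t-1}(g_t · L_{t,T}(·, 1)) | ≤ (σ₊²/(σ₋·c₋))·ρ^{t−s}·osc(h), where for t = T the factor L_{T,T}(x',1) equals 1. -/

import Mathlib

open MeasureTheory

noncomputable section

variable {X : Type*} [MeasurableSpace X]

/-- `ell ν q g s n x y` is the kernel density `ℓ_{s, s+n+1}(x, y)`: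
`ℓ_{s,s+1}(x,y) = q(x,y) g_{s+1}(y)` and
`ℓ_{s,t+1}(x,y) = ∫ ℓ_{s,t}(x,z) q(z,y) g_{t+1}(y) ν(dz)`. -/
def ell (ν : Measure X) (q : X → X → ℝ) (g : ℕ → X → ℝ) (s : ℕ) : ℕ → X → X → ℝ
  | 0 => fun x y => q x y * g (s + 1) y
  | n + 1 => fun x y => ∫ z, ell ν q g s n x z * (q z y * g (s + n + 2) y) ∂ν

/-- `ℓ_{s,t}` for `s < t`. -/
def ellST (ν : Measure X) (q : X → X → ℝ) (g : ℕ → X → ℝ) (s t : ℕ) : X → X → ℝ :=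
  ell ν q g s (t - s - 1)

/-- `L_{s,t}(x,h) = ∫ ℓ_{s,t}(x,y) h(y) ν(dy)`, with the convention `L_{t,t}(x,h) = h x`. -/
def Lop (ν : Measure X) (q : X → X → ℝ) (g : ℕ → X → ℝ) (s t : ℕ) (x : X) (h : X → ℝ) : ℝ :=
  if s < t then ∫ y, ellST ν q g s t x y * h y ∂ν else h x

/-- filtering distribution `φ_{t|t}(h)` (for `t = 0` this is `χ(g₀h)/χ(g₀)`). -/
def philt (ν χ : Measure X) (q : X → X → ℝ) (g : ℕ → X → ℝ) (t : ℕ) (h : X → ℝ) : ℝ :=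
  (∫ x, g 0 x * Lop ν q g 0 t x h ∂χ) / ∫ x, g 0 x * Lop ν q g 0 t x (fun _ => 1) ∂χ

/-- one-step predictor `φ_{t|t-1}(h) = φ_{t-1|t-1}(x ↦ ∫ q(x,y)h(y)ν(dy))`. -/
def phipred (ν χ : Measure X) (q : X → X → ℝ) (g : ℕ → X → ℝ) (t : ℕ) (h : X → ℝ) : ℝ :=
  philt ν χ q g (t - 1) (fun x => ∫ y, q x y * h y ∂ν)

/-- importance weight `ω_t(x,x') = q(x,x') g_t(x') / (ϑ_t(x) p_t(x,x'))`. -/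
def omegaFn (q : X → X → ℝ) (g : ℕ → X → ℝ) (ϑ : ℕ → X → ℝ) (p : ℕ → X → X → ℝ)
    (t : ℕ) (x y : X) : ℝ :=
  q x y * g t y / (ϑ t x * p t x y)

/-- oscillation of a function -/
def osc {Y : Type*} (h : Y → ℝ) : ℝ := ⨆ pr : Y × Y, |h pr.1 - h pr.2|

/-- marginal smoothing distribution `φ_{s|T}(h)`. -/
def phismooth (ν χ : Measure X) (q : X → X → ℝ) (g : ℕ → X → ℝ) (s T : ℕ) (h : X → ℝ) : ℝ :=
  philt ν χ q g s (fun x => h x * Lop ν q g s T x fun _ => 1) /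
    philt ν χ q g s (fun x => Lop ν q g s T x fun _ => 1)

/-- unnormalized joint smoothing functional of the states at times `s` and `t1` (`s ≤ t1`). -/
def jointNum (ν χ : Measure X) (q : X → X → ℝ) (g : ℕ → X → ℝ) (s t1 : ℕ)
    (ψ : X → X → ℝ) : ℝ :=
  ∫ x0, g 0 x0 * ∫ xs, ellST ν q g 0 s x0 xs *
    (if s < t1 then ∫ y, ellST ν q g s t1 xs y * ψ xs y ∂ν else ψ xs xs) ∂ν ∂χ

/-- joint smoothing distribution `φ_{s,t1|t1}(ψ)` (`s ≤ t1`). -/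
def jointSm (ν χ : Measure X) (q : X → X → ℝ) (g : ℕ → X → ℝ) (s t1 : ℕ)
    (ψ : X → X → ℝ) : ℝ :=
  jointNum ν χ q g s t1 ψ / jointNum ν χ q g s t1 fun _ _ => 1

end

noncomputable section

variable {X : Type*} [MeasurableSpace X]

/-- Bounded measurable real functions. -/
structure BddMeasurable {Y : Type*} [MeasurableSpace Y] (f : Y → ℝ) : Prop where
  measurable : Measurable f
  bdd : ∃ K, ∀ x, |f x| ≤ K

namespace BddMeasurable

variable {Y Z : Type*} [MeasurableSpace Y] [MeasurableSpace Z] {f k : Y → ℝ}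

theorem const (c : ℝ) : BddMeasurable fun _ : Y => c :=
  ⟨measurable_const, |c|, fun _ => le_rfl⟩

theorem mul (hf : BddMeasurable f) (hk : BddMeasurable k) :
    BddMeasurable fun x => f x * k x := by
  obtain ⟨A, hA⟩ := hf.bdd
  obtain ⟨B, hB⟩ := hk.bdd
  refine ⟨hf.measurable.mul hk.measurable, A * B, fun x => ?_⟩
  rw [abs_mul]
  exact mul_le_mul (hA x) (hB x) (abs_nonneg _) ((abs_nonneg _).trans (hA x))

theorem add (hf : BddMeasurable f) (hk : BddMeasurable k) :
    BddMeasurable fun x => f x + k x := by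
  obtain ⟨A, hA⟩ := hf.bdd
  obtain ⟨B, hB⟩ := hk.bdd
  exact ⟨hf.measurable.add hk.measurable, A + B,
    fun x => (abs_add_le _ _).trans (add_le_add (hA x) (hB x))⟩

theorem comp (hf : BddMeasurable f) {u : Z → Y} (hu : Measurable u) :
    BddMeasurable fun z => f (u z) := by
  obtain ⟨A, hA⟩ := hf.bdd
  exact ⟨hf.measurable.comp hu, A, fun z => hA (u z)⟩

theorem integrable (hf : BddMeasurable f) (μ : Measure Y) [IsFiniteMeasure μ] :
    Integrable f μ := by
  obtain ⟨A, hA⟩ := hf.bdd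
  exact Integrable.of_bound hf.measurable.aestronglyMeasurable A (.of_forall hA)

theorem integral_right {f : Y → Z → ℝ} (hf : BddMeasurable fun p : Y × Z => f p.1 p.2)
    (μ : Measure Z) [IsProbabilityMeasure μ] : BddMeasurable fun y => ∫ z, f y z ∂μ := by
  obtain ⟨A, hA⟩ := hf.bdd
  refine ⟨(StronglyMeasurable.integral_prod_right (f := f)
    hf.measurable.stronglyMeasurable).measurable, A, fun y => ?_⟩
  simpa using norm_integral_le_of_norm_le_const (μ := μ) (f := f y) (C := A)
    (.of_forall fun z => hA (y, z))

end BddMeasurable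

theorem abs_sub_le_osc {Y : Type*} {h : Y → ℝ} (hh : ∃ K, ∀ x, |h x| ≤ K) (x y : Y) :
    |h x - h y| ≤ osc h := by
  obtain ⟨K, hK⟩ := hh
  refine le_ciSup (f := fun pr : Y × Y => |h pr.1 - h pr.2|) ⟨K + K, ?_⟩ (x, y)
  rintro _ ⟨p, rfl⟩
  exact (abs_sub _ _).trans (add_le_add (hK _) (hK _))

/-- The unnormalized one-step kernel `f ↦ ∫ q(·,y) g_t(y) f(y) ν(dy)`. -/
def stepOp (ν : Measure X) (q : X → X → ℝ) (g : ℕ → X → ℝ) (t : ℕ) (f : X → ℝ) (x : X) : ℝ :=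
  ∫ y, q x y * (g t y * f y) ∂ν

/-- The composition of the one-step kernels at times `s + 1, …, s + n`. -/
def stepIter (ν : Measure X) (q : X → X → ℝ) (g : ℕ → X → ℝ) (s : ℕ) :
    ℕ → (X → ℝ) → X → ℝ
  | 0, f => f
  | n + 1, f => stepIter ν q g s n (stepOp ν q g (s + n + 1) f)

theorem stepIter_add (ν : Measure X) (q : X → X → ℝ) (g : ℕ → X → ℝ) (s m n : ℕ) (f : X → ℝ) :
    stepIter ν q g s (m + n) f = stepIter ν q g s m (stepIter ν q g (s + m) n f) := by
  induction n generalizing f with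
  | zero => rfl
  | succ n ih =>
    change stepIter ν q g s (m + n) (stepOp ν q g (s + (m + n) + 1) f) = _
    rw [ih, ← add_assoc s m n]
    rfl

/-- Bounded mixing conditions on the transition density and the potentials. -/
structure StrongMixing (ν : Measure X) (σm σp cm : ℝ) (q : X → X → ℝ) (g : ℕ → X → ℝ) :
    Prop where
  prob : IsProbabilityMeasure ν
  low_pos : 0 < σm
  const_pos : 0 < cm
  low_le : ∀ x y, σm ≤ q x y
  le_up : ∀ x y, q x y ≤ σp
  bddMeas_q : BddMeasurable fun p : X × X => q p.1 p.2
  bddMeas_g : ∀ t, BddMeasurable (g t)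
  nonneg_g : ∀ t x, 0 ≤ g t x
  step_one : ∀ t, 1 ≤ t → ∀ x, cm ≤ ∫ y, q x y * g t y ∂ν

namespace StrongMixing

variable {ν : Measure X} {σm σp cm : ℝ} {q : X → X → ℝ} {g : ℕ → X → ℝ}

theorem bddMeas_q_right (H : StrongMixing ν σm σp cm q g) (x : X) : BddMeasurable (q x) :=
  H.bddMeas_q.comp measurable_prodMk_left

theorem bddMeas_q_left (H : StrongMixing ν σm σp cm q g) (y : X) :
    BddMeasurable fun x => q x y :=
  H.bddMeas_q.comp measurable_prodMk_right

theorem bddMeas_stepOp (H : StrongMixing ν σm σp cm q g) (t : ℕ) {f : X → ℝ}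
    (hf : BddMeasurable f) : BddMeasurable (stepOp ν q g t f) := by
  have := H.prob
  exact BddMeasurable.integral_right (f := fun x y => q x y * (g t y * f y))
    (H.bddMeas_q.mul (((H.bddMeas_g t).mul hf).comp measurable_snd)) ν

theorem bddMeas_stepIter (H : StrongMixing ν σm σp cm q g) (s n : ℕ) {f : X → ℝ}
    (hf : BddMeasurable f) : BddMeasurable (stepIter ν q g s n f) := by
  induction n generalizing f with
  | zero => exact hf
  | succ n ih => exact ih (H.bddMeas_stepOp _ hf)

theorem integrable_step (H : StrongMixing ν σm σp cm q g) (t : ℕ) {f : X → ℝ}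
    (hf : BddMeasurable f) (x : X) : Integrable (fun y => q x y * (g t y * f y)) ν := by
  have := H.prob
  exact ((H.bddMeas_q_right x).mul ((H.bddMeas_g t).mul hf)).integrable ν

theorem stepOp_lin (H : StrongMixing ν σm σp cm q g) (t : ℕ) {f k : X → ℝ}
    (hf : BddMeasurable f) (hk : BddMeasurable k) (a b : ℝ) :
    stepOp ν q g t (fun x => a * f x + b * k x) =
      fun x => a * stepOp ν q g t f x + b * stepOp ν q g t k x := by
  funext x
  simp only [stepOp]
  rw [← integral_const_mul, ← integral_const_mul, ← integral_add
    ((H.integrable_step t hf x).const_mul a) ((H.integrable_step t hk x).const_mul b)]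
  congr 1 with y
  ring

theorem stepOp_mono (H : StrongMixing ν σm σp cm q g) (t : ℕ) {f k : X → ℝ}
    (hf : BddMeasurable f) (hk : BddMeasurable k) (hfk : ∀ x, f x ≤ k x) (x : X) :
    stepOp ν q g t f x ≤ stepOp ν q g t k x :=
  integral_mono (H.integrable_step t hf x) (H.integrable_step t hk x) fun y =>
    mul_le_mul_of_nonneg_left (mul_le_mul_of_nonneg_left (hfk y) (H.nonneg_g t y))
      (H.low_pos.le.trans (H.low_le x y))

theorem stepOp_lower (H : StrongMixing ν σm σp cm q g) {t : ℕ} (ht : 1 ≤ t) {f : X → ℝ}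
    (hf : BddMeasurable f) {δ : ℝ} (hδ : 0 ≤ δ) (hfδ : ∀ x, δ ≤ f x) (x : X) :
    cm * δ ≤ stepOp ν q g t f x := by
  calc cm * δ ≤ (∫ y, q x y * g t y ∂ν) * δ :=
        mul_le_mul_of_nonneg_right (H.step_one t ht x) hδ
    _ = stepOp ν q g t (fun _ => δ) x := by
        simp only [stepOp, ← mul_assoc, integral_mul_const]
    _ ≤ _ := H.stepOp_mono t (.const δ) hf hfδ x

/-- For nonnegative functions the one-step kernel is comparable with the measure `g_t dν`. -/
theorem stepOp_mem_Icc (H : StrongMixing ν σm σp cm q g) (t : ℕ) {f : X → ℝ}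
    (hf : BddMeasurable f) (hf0 : ∀ x, 0 ≤ f x) (x : X) :
    σm * ∫ y, g t y * f y ∂ν ≤ stepOp ν q g t f x ∧
      stepOp ν q g t f x ≤ σp * ∫ y, g t y * f y ∂ν := by
  have := H.prob
  have hi : Integrable (fun y => g t y * f y) ν := ((H.bddMeas_g t).mul hf).integrable ν
  rw [← integral_const_mul, ← integral_const_mul]
  have h0 := fun y => mul_nonneg (H.nonneg_g t y) (hf0 y)
  exact ⟨integral_mono (hi.const_mul _) (H.integrable_step t hf x) fun y =>
      mul_le_mul_of_nonneg_right (H.low_le x y) (h0 y),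
    integral_mono (H.integrable_step t hf x) (hi.const_mul _) fun y =>
      mul_le_mul_of_nonneg_right (H.le_up x y) (h0 y)⟩

theorem up_pos (H : StrongMixing ν σm σp cm q g) (x : X) : 0 < σp :=
  H.low_pos.trans_le ((H.low_le x x).trans (H.le_up x x))

theorem integral_pos (H : StrongMixing ν σm σp cm q g) {t : ℕ} (ht : 1 ≤ t) {f : X → ℝ}
    (hf : BddMeasurable f) {δ : ℝ} (hδ : 0 < δ) (hfδ : ∀ x, δ ≤ f x) (x : X) :
    0 < ∫ y, g t y * f y ∂ν := by
  have h1 := H.stepOp_lower ht hf hδ.le hfδ x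
  have h2 := (H.stepOp_mem_Icc t hf (fun y => hδ.le.trans (hfδ y)) x).2
  exact pos_of_mul_pos_right ((mul_pos H.const_pos hδ).trans_le (h1.trans h2)) (H.up_pos x).le

theorem stepIter_lin (H : StrongMixing ν σm σp cm q g) (s n : ℕ) {f k : X → ℝ}
    (hf : BddMeasurable f) (hk : BddMeasurable k) (a b : ℝ) :
    stepIter ν q g s n (fun x => a * f x + b * k x) =
      fun x => a * stepIter ν q g s n f x + b * stepIter ν q g s n k x := by
  induction n generalizing f k with
  | zero => rfl
  | succ n ih =>
    simp only [stepIter]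
    rw [H.stepOp_lin _ hf hk, ih (H.bddMeas_stepOp _ hf) (H.bddMeas_stepOp _ hk)]

theorem stepIter_mono (H : StrongMixing ν σm σp cm q g) (s n : ℕ) {f k : X → ℝ}
    (hf : BddMeasurable f) (hk : BddMeasurable k) (hfk : ∀ x, f x ≤ k x) (x : X) :
    stepIter ν q g s n f x ≤ stepIter ν q g s n k x := by
  induction n generalizing f k with
  | zero => exact hfk x
  | succ n ih =>
    exact ih (H.bddMeas_stepOp _ hf) (H.bddMeas_stepOp _ hk) (H.stepOp_mono _ hf hk hfk)

theorem stepIter_lower (H : StrongMixing ν σm σp cm q g) (s n : ℕ) {f : X → ℝ}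
    (hf : BddMeasurable f) (hpos : ∃ δ > 0, ∀ x, δ ≤ f x) :
    ∃ δ > 0, ∀ x, δ ≤ stepIter ν q g s n f x := by
  induction n generalizing f with
  | zero => exact hpos
  | succ n ih =>
    obtain ⟨δ, hδ, hfδ⟩ := hpos
    exact ih (H.bddMeas_stepOp _ hf) ⟨cm * δ, mul_pos H.const_pos hδ,
      H.stepOp_lower (by omega) hf hδ.le hfδ⟩

/-- One step of the Doeblin contraction for ratios. -/
theorem stepOp_contract (H : StrongMixing ν σm σp cm q g) {t : ℕ} (ht : 1 ≤ t) (x₀ : X)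
    {F G : X → ℝ} (hF : BddMeasurable F) (hG : BddMeasurable G) (hpos : ∃ δ > 0, ∀ x, δ ≤ G x)
    {a b : ℝ} (ha : ∀ x, a * G x ≤ F x) (hb : ∀ x, F x ≤ b * G x) :
    ∃ a' b', b' - a' = (1 - σm / σp) * (b - a) ∧
      (∀ x, a' * stepOp ν q g t G x ≤ stepOp ν q g t F x) ∧
      ∀ x, stepOp ν q g t F x ≤ b' * stepOp ν q g t G x := by
  have := H.prob
  obtain ⟨δ, hδ, hGδ⟩ := hpos
  have hσp := H.up_pos x₀
  have hσm := H.low_pos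
  set J := ∫ y, g t y * G y ∂ν with hJ
  set JF := ∫ y, g t y * F y ∂ν with hJF
  have hJpos : 0 < J := H.integral_pos ht hG hδ hGδ x₀
  have hup := fun x => (H.stepOp_mem_Icc t hG (fun y => hδ.le.trans (hGδ y)) x).2
  have hint : ∀ u v : ℝ, ∫ y, g t y * (u * F y + v * G y) ∂ν = u * JF + v * J := by
    intro u v
    rw [hJ, hJF, ← integral_const_mul, ← integral_const_mul, ← integral_add
      ((((H.bddMeas_g t).mul hF).integrable ν).const_mul u)
      ((((H.bddMeas_g t).mul hG).integrable ν).const_mul v)]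
    congr 1 with y
    ring
  have key : ∀ u v : ℝ, (∀ x, 0 ≤ u * F x + v * G x) → ∀ x,
      σm / σp * ((u * JF + v * J) / J) * stepOp ν q g t G x ≤
        u * stepOp ν q g t F x + v * stepOp ν q g t G x := by
    intro u v h0 x
    have h1 := (H.stepOp_mem_Icc t (((BddMeasurable.const u).mul hF).add
      ((BddMeasurable.const v).mul hG)) h0 x).1
    rw [hint, H.stepOp_lin t hF hG] at h1
    refine le_trans ?_ h1
    have h2 : 0 ≤ u * JF + v * J := by
      rw [← hint]
      exact integral_nonneg fun y => mul_nonneg (H.nonneg_g t y) (h0 y)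
    calc σm / σp * ((u * JF + v * J) / J) * stepOp ν q g t G x
        ≤ σm / σp * ((u * JF + v * J) / J) * (σp * J) :=
          mul_le_mul_of_nonneg_left (hup x) (by positivity)
      _ = σm * (u * JF + v * J) := by field_simp
  refine ⟨a + σm / σp * (JF / J - a), b - σm / σp * (b - JF / J), by ring, fun x => ?_, fun x => ?_⟩
  · have h1 := key 1 (-a) (fun x => by linarith [ha x]) x
    have h2 : (1 * JF + -a * J) / J = JF / J - a := by field_simp; ring
    rw [h2] at h1
    linarith
  · have h1 := key (-1) b (fun x => by linarith [hb x]) x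
    have h2 : (-1 * JF + b * J) / J = b - JF / J := by field_simp; ring
    rw [h2] at h1
    linarith

theorem stepIter_contract (H : StrongMixing ν σm σp cm q g) (s n : ℕ) (x₀ : X)
    {F G : X → ℝ} (hF : BddMeasurable F) (hG : BddMeasurable G) (hpos : ∃ δ > 0, ∀ x, δ ≤ G x)
    {a b : ℝ} (ha : ∀ x, a * G x ≤ F x) (hb : ∀ x, F x ≤ b * G x) :
    ∃ a' b', b' - a' = (1 - σm / σp) ^ n * (b - a) ∧
      (∀ x, a' * stepIter ν q g s n G x ≤ stepIter ν q g s n F x) ∧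
      ∀ x, stepIter ν q g s n F x ≤ b' * stepIter ν q g s n G x := by
  induction n generalizing F G a b with
  | zero => exact ⟨a, b, by simp, ha, hb⟩
  | succ n ih =>
    obtain ⟨a₁, b₁, hab, ha₁, hb₁⟩ :=
      H.stepOp_contract (t := s + n + 1) (by omega) x₀ hF hG hpos ha hb
    obtain ⟨a₂, b₂, hab₂, h₂⟩ := ih (H.bddMeas_stepOp _ hF) (H.bddMeas_stepOp _ hG)
      (H.stepIter_lower (s + n) 1 hG hpos) ha₁ hb₁
    exact ⟨a₂, b₂, by rw [hab₂, hab]; ring, h₂⟩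

/-- Harnack-type comparison of the backward functions at two points. -/
theorem stepIter_harnack (H : StrongMixing ν σm σp cm q g) (s n : ℕ) (x y : X) :
    σm / σp * stepIter ν q g s n (fun _ => 1) x ≤ stepIter ν q g s n (fun _ => 1) y := by
  have hσp := H.up_pos x
  have hσm := H.low_pos
  cases n with
  | zero =>
    simp only [stepIter, mul_one]
    exact (div_le_one hσp).2 ((H.low_le x x).trans (H.le_up x x))
  | succ n =>
    rw [add_comm n 1, stepIter_add]
    change σm / σp * stepOp ν q g (s + 1) _ x ≤ stepOp ν q g (s + 1) _ y
    set v := stepIter ν q g (s + 1) n fun _ => 1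
    obtain ⟨δ, hδ, hv⟩ := H.stepIter_lower (s + 1) n (BddMeasurable.const 1)
      ⟨1, one_pos, fun _ => le_rfl⟩
    have hvm : BddMeasurable v := H.bddMeas_stepIter (s + 1) n (.const 1)
    have hb := H.stepOp_mem_Icc (s + 1) hvm fun z => hδ.le.trans (hv z)
    calc σm / σp * stepOp ν q g (s + 1) v x
        ≤ σm / σp * (σp * ∫ z, g (s + 1) z * v z ∂ν) :=
          mul_le_mul_of_nonneg_left (hb x).2 (by positivity)
      _ = σm * ∫ z, g (s + 1) z * v z ∂ν := by field_simp
      _ ≤ _ := (hb y).1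

theorem bddMeas_ell (H : StrongMixing ν σm σp cm q g) (s n : ℕ) (x : X) :
    BddMeasurable (ell ν q g s n x) := by
  have := H.prob
  induction n with
  | zero => exact (H.bddMeas_q_right x).mul (H.bddMeas_g _)
  | succ n ih =>
    exact BddMeasurable.integral_right
      (f := fun y z => ell ν q g s n x z * (q z y * g (s + n + 2) y))
      ((ih.comp measurable_snd).mul ((H.bddMeas_q.comp measurable_swap).mul
        ((H.bddMeas_g _).comp measurable_fst))) ν

theorem integral_ell (H : StrongMixing ν σm σp cm q g) (s n : ℕ) {f : X → ℝ}
    (hf : BddMeasurable f) (x : X) :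
    ∫ y, ell ν q g s n x y * f y ∂ν = stepIter ν q g s (n + 1) f x := by
  have := H.prob
  induction n generalizing f with
  | zero => simp only [ell, stepIter, stepOp, mul_assoc, add_zero]
  | succ n ih =>
    change _ = stepIter ν q g s (n + 1) (stepOp ν q g (s + (n + 1) + 1) f) x
    rw [← ih (H.bddMeas_stepOp _ hf)]
    simp only [ell, stepOp, ← integral_mul_const, ← integral_const_mul]
    rw [integral_integral_swap]
    · congr 1 with z
      congr 1 with y
      rw [show s + n + 2 = s + (n + 1) + 1 by ring]
      ring
    · exact ((((H.bddMeas_ell s n x).comp measurable_snd).mul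
        ((H.bddMeas_q.comp measurable_swap).mul ((H.bddMeas_g (s + n + 2)).comp
          measurable_fst))).mul (hf.comp measurable_fst)).integrable (ν.prod ν)

theorem Lop_eq_stepIter (H : StrongMixing ν σm σp cm q g) (s n : ℕ) {f : X → ℝ}
    (hf : BddMeasurable f) (x : X) : Lop ν q g s (s + n) x f = stepIter ν q g s n f x := by
  cases n with
  | zero => simp [Lop, stepIter]
  | succ n =>
    rw [← H.integral_ell s n hf, Lop, if_pos (by omega), ellST,
      show s + (n + 1) - s - 1 = n by omega]

end StrongMixing

/-- The unnormalized filter at time `s`. -/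
def unnormFilter (ν χ : Measure X) (q : X → X → ℝ) (g : ℕ → X → ℝ) (s : ℕ) (f : X → ℝ) : ℝ :=
  ∫ x, g 0 x * stepIter ν q g 0 s f x ∂χ

namespace StrongMixing

variable {ν χ : Measure X} {σm σp cm : ℝ} {q : X → X → ℝ} {g : ℕ → X → ℝ}

theorem unnormFilter_lin [IsProbabilityMeasure χ]
    (H : StrongMixing ν σm σp cm q g) (s : ℕ) {f k : X → ℝ}
    (hf : BddMeasurable f) (hk : BddMeasurable k) (a b : ℝ) :
    unnormFilter ν χ q g s (fun x => a * f x + b * k x) =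
      a * unnormFilter ν χ q g s f + b * unnormFilter ν χ q g s k := by
  simp only [unnormFilter]
  rw [H.stepIter_lin 0 s hf hk, ← integral_const_mul, ← integral_const_mul, ← integral_add
    ((((H.bddMeas_g 0).mul (H.bddMeas_stepIter 0 s hf)).integrable χ).const_mul a)
    ((((H.bddMeas_g 0).mul (H.bddMeas_stepIter 0 s hk)).integrable χ).const_mul b)]
  congr 1 with y
  ring

theorem unnormFilter_mono [IsProbabilityMeasure χ]
    (H : StrongMixing ν σm σp cm q g) (s : ℕ) {f k : X → ℝ}
    (hf : BddMeasurable f) (hk : BddMeasurable k) (hfk : ∀ x, f x ≤ k x) :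
    unnormFilter ν χ q g s f ≤ unnormFilter ν χ q g s k :=
  integral_mono (((H.bddMeas_g 0).mul (H.bddMeas_stepIter 0 s hf)).integrable χ)
    (((H.bddMeas_g 0).mul (H.bddMeas_stepIter 0 s hk)).integrable χ)
    fun x => mul_le_mul_of_nonneg_left (H.stepIter_mono 0 s hf hk hfk x) (H.nonneg_g 0 x)

theorem unnormFilter_const_mul [IsProbabilityMeasure χ]
    (H : StrongMixing ν σm σp cm q g) (s : ℕ) {f : X → ℝ}
    (hf : BddMeasurable f) (a : ℝ) :
    unnormFilter ν χ q g s (fun x => a * f x) = a * unnormFilter ν χ q g s f := by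
  simpa using H.unnormFilter_lin (χ := χ) s hf hf a 0

theorem abs_unnormFilter_le [IsProbabilityMeasure χ]
    (H : StrongMixing ν σm σp cm q g) (s : ℕ) {f k : X → ℝ}
    (hf : BddMeasurable f) (hk : BddMeasurable k) {c : ℝ} (hfk : ∀ x, |f x| ≤ c * k x) :
    |unnormFilter ν χ q g s f| ≤ c * unnormFilter ν χ q g s k := by
  have h1 := H.unnormFilter_mono (χ := χ) s hf ((BddMeasurable.const c).mul hk)
    fun x => (abs_le.1 (hfk x)).2
  have h2 := H.unnormFilter_mono (χ := χ) s ((BddMeasurable.const (-c)).mul hk) hf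
    fun x => by linarith [(abs_le.1 (hfk x)).1]
  rw [H.unnormFilter_const_mul s hk] at h1 h2
  exact abs_le.2 ⟨by linarith, h1⟩

theorem unnormFilter_pos [IsProbabilityMeasure χ]
    (H : StrongMixing ν σm σp cm q g) (hχ : cm ≤ ∫ x, g 0 x ∂χ) (s : ℕ)
    {f : X → ℝ} (hf : BddMeasurable f) (hpos : ∃ δ > 0, ∀ x, δ ≤ f x) :
    0 < unnormFilter ν χ q g s f := by
  obtain ⟨δ, hδ, hfδ⟩ := H.stepIter_lower 0 s hf hpos
  calc 0 < cm * δ := mul_pos H.const_pos hδ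
    _ ≤ (∫ x, g 0 x ∂χ) * δ := mul_le_mul_of_nonneg_right hχ hδ.le
    _ = ∫ x, g 0 x * δ ∂χ := (integral_mul_const _ _).symm
    _ ≤ _ := integral_mono (((H.bddMeas_g 0).mul (.const δ)).integrable χ)
      (((H.bddMeas_g 0).mul (H.bddMeas_stepIter 0 s hf)).integrable χ)
      fun x => mul_le_mul_of_nonneg_left (hfδ x) (H.nonneg_g 0 x)

theorem unnormFilter_add (s n : ℕ) (f : X → ℝ) :
    unnormFilter ν χ q g (s + n) f = unnormFilter ν χ q g s (stepIter ν q g s n f) := by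
  simp only [unnormFilter, stepIter_add, zero_add]

theorem philt_eq (H : StrongMixing ν σm σp cm q g) (s : ℕ) {f : X → ℝ}
    (hf : BddMeasurable f) :
    philt ν χ q g s f = unnormFilter ν χ q g s f / unnormFilter ν χ q g s fun _ => 1 := by
  have h0 : ∀ {k : X → ℝ}, BddMeasurable k → ∀ x, Lop ν q g 0 s x k = stepIter ν q g 0 s k x :=
    fun hk x => by simpa using H.Lop_eq_stepIter 0 s hk x
  simp only [philt, unnormFilter, h0 hf, h0 (.const 1)]

theorem jointNum_eq (H : StrongMixing ν σm σp cm q g) {s : ℕ} (hs : 1 ≤ s) (n : ℕ)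
    {h k : X → ℝ} (hh : BddMeasurable h) (hk : BddMeasurable k) :
    jointNum ν χ q g s (s + n) (fun x y => h x * k y) =
      unnormFilter ν χ q g s fun x => h x * stepIter ν q g s n k x := by
  have h1 : ∀ x, (if s < s + n then ∫ y, ellST ν q g s (s + n) x y * (h x * k y) ∂ν
      else h x * k x) = h x * stepIter ν q g s n k x := by
    intro x
    rw [← H.Lop_eq_stepIter s n hk, Lop]
    split_ifs
    · rw [← integral_const_mul]
      congr 1 with y
      ring
    · rfl
  obtain ⟨m, rfl⟩ := Nat.exists_eq_add_of_le' hs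
  simp only [jointNum, h1, unnormFilter]
  simp only [← H.integral_ell 0 m (hh.mul (H.bddMeas_stepIter (m + 1) n hk)), ellST]
  rfl

/-- Two-sided bounds, uniform in `x`, for the ratio `q(x, x') / stepOp w x`, where `w` satisfies a
Harnack inequality. -/
theorem exists_ratio_bounds (H : StrongMixing ν σm σp cm q g) {t : ℕ} (ht : 1 ≤ t) (x' : X)
    {w : X → ℝ} (hw : BddMeasurable w) (hpos : ∃ δ > 0, ∀ x, δ ≤ w x)
    (hharnack : ∀ x, σm / σp * w x' ≤ w x) :
    ∃ a b, (∀ x, a * stepOp ν q g t w x ≤ q x x') ∧ (∀ x, q x x' ≤ b * stepOp ν q g t w x) ∧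
      b - a ≤ 2 * (1 - σm / σp) * b ∧ b * w x' ≤ σp ^ 2 / (σm * cm) := by
  obtain ⟨δ, hδ, hwδ⟩ := hpos
  have hσp := H.up_pos x'
  have hσm := H.low_pos
  have hcm := H.const_pos
  have hwx : 0 < w x' := hδ.trans_le (hwδ x')
  set J := ∫ y, g t y * w y ∂ν
  have hJ : 0 < J := H.integral_pos ht hw hδ hwδ x'
  have hb := H.stepOp_mem_Icc t hw fun z => hδ.le.trans (hwδ z)
  set κ := cm * (σm / σp * w x') with hκ
  have hκpos : 0 < κ := by positivity
  set K := max κ (σm * J)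
  have hKpos : 0 < K := lt_max_of_lt_left hκpos
  have hK : ∀ x, K ≤ stepOp ν q g t w x := fun x =>
    max_le (H.stepOp_lower ht hw (by positivity) hharnack x) (hb x).1
  refine ⟨σp / K * (σm / σp) ^ 2, σp / K, fun x => ?_, fun x => ?_, ?_, ?_⟩
  · refine le_trans ?_ (H.low_le x x')
    calc σp / K * (σm / σp) ^ 2 * stepOp ν q g t w x
        ≤ σp / (σm * J) * (σm / σp) ^ 2 * (σp * J) := by
          gcongr
          · exact hKpos.le.trans (hK x)
          · exact le_max_right _ _
          · exact (hb x).2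
      _ = σm := by field_simp
  · refine (H.le_up x x').trans ?_
    rw [div_mul_eq_mul_div, le_div_iff₀ hKpos]
    exact mul_le_mul_of_nonneg_left (hK x) hσp.le
  · have : 0 ≤ σp / K * (1 - σm / σp) ^ 2 := by positivity
    nlinarith
  · calc σp / K * w x' ≤ σp / κ * w x' := by
          gcongr
          exact le_max_left _ _
      _ = σp ^ 2 / (σm * cm) := by rw [hκ]; field_simp

/-- Covariance bound: `h` is centred under the weighted filter and `F / G ∈ [a, b]`. -/
theorem abs_unnormFilter_centred_le [IsProbabilityMeasure χ]
    (H : StrongMixing ν σm σp cm q g)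
    (hχ : cm ≤ ∫ x, g 0 x ∂χ) (s : ℕ) {h F G : X → ℝ} (hh : BddMeasurable h)
    (hF : BddMeasurable F) (hG : BddMeasurable G) (hpos : ∃ δ > 0, ∀ x, δ ≤ G x)
    (hzero : unnormFilter ν χ q g s (fun x => h x * G x) = 0) {a b : ℝ}
    (ha : ∀ x, a * G x ≤ F x) (hb : ∀ x, F x ≤ b * G x) :
    |unnormFilter ν χ q g s fun x => h x * F x| ≤
      osc h * ((b - a) / 2) * unnormFilter ν χ q g s G := by
  have hGpos := H.unnormFilter_pos hχ s hG hpos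
  obtain ⟨δ, hδ, hGδ⟩ := hpos
  have hG0 := fun x => hδ.le.trans (hGδ x)
  have hosc : ∀ x, |h x| ≤ osc h := by
    intro x
    have h1 := H.abs_unnormFilter_le (χ := χ) s (f := fun y => h x * G y + (-1) * (h y * G y))
      (((BddMeasurable.const _).mul hG).add ((BddMeasurable.const _).mul (hh.mul hG))) hG
      (c := osc h) (fun y => by
        rw [show h x * G y + (-1) * (h y * G y) = (h x - h y) * G y by ring, abs_mul,
          abs_of_nonneg (hG0 y)]
        exact mul_le_mul_of_nonneg_right (abs_sub_le_osc hh.bdd x y) (hG0 y))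
    rw [H.unnormFilter_lin s hG (hh.mul hG), hzero, mul_zero, add_zero, abs_mul,
      abs_of_pos hGpos] at h1
    exact le_of_mul_le_mul_right h1 hGpos
  have h1 := H.abs_unnormFilter_le (χ := χ) s
    (f := fun y => 1 * (h y * F y) + (-((a + b) / 2)) * (h y * G y))
    (((BddMeasurable.const _).mul (hh.mul hF)).add ((BddMeasurable.const _).mul (hh.mul hG))) hG
    (c := osc h * ((b - a) / 2)) (fun y => by
      rw [show 1 * (h y * F y) + (-((a + b) / 2)) * (h y * G y) =
        h y * (F y - (a + b) / 2 * G y) by ring, abs_mul, mul_assoc]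
      refine mul_le_mul (hosc y) ?_ (abs_nonneg _) ((abs_nonneg _).trans (hosc y))
      rw [abs_le]
      constructor <;> linarith [ha y, hb y])
  rwa [H.unnormFilter_lin s (hh.mul hF) (hh.mul hG), hzero, mul_zero, add_zero, one_mul] at h1

end StrongMixing

end

theorem stmt_13 {X : Type*} [MeasurableSpace X] (ν : Measure X) (hν : ν Set.univ = 1)
    (σm σp cm : ℝ) (hσm : 0 < σm) (hσmp : σm ≤ σp) (hcm : 0 < cm)
    (q : X → X → ℝ) (hqmeas : Measurable fun pr : X × X => q pr.1 pr.2)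
    (hq : ∀ x y, σm ≤ q x y ∧ q x y ≤ σp)
    (χ : Measure X) [IsProbabilityMeasure χ]
    (g : ℕ → X → ℝ) (hgmeas : ∀ t, Measurable (g t))
    (hg0 : ∀ t x, 0 ≤ g t x) (hgb : ∃ K, ∀ t x, g t x ≤ K)
    (hχg0 : cm ≤ ∫ x, g 0 x ∂χ)
    (hqg : ∀ t, 1 ≤ t → ∀ x, cm ≤ ∫ y, q x y * g t y ∂ν)
    (s t T : ℕ) (hs : 1 ≤ s) (hst : s < t) (htT : t ≤ T)
    (h : X → ℝ) (hhm : Measurable h) (hhb : ∃ K, ∀ x, |h x| ≤ K)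
    (hzero : phismooth ν χ q g s T h = 0) (x' : X) :
    |jointSm ν χ q g s (t - 1) (fun xs y => h xs * q y x') *
        Lop ν q g t T x' (fun _ => 1) /
        phipred ν χ q g t (fun z => g t z * Lop ν q g t T z fun _ => 1)| ≤
      (σp ^ 2 / (σm * cm)) * (1 - σm / σp) ^ (t - s) * osc h := by
  have hσp : 0 < σp := hσm.trans_le hσmp
  have H : StrongMixing ν σm σp cm q g :=
    { prob := ⟨hν⟩
      low_pos := hσm
      const_pos := hcm
      low_le := fun x y => (hq x y).1
      le_up := fun x y => (hq x y).2
      bddMeas_q := ⟨hqmeas, σp, fun p => abs_le.2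
        ⟨by linarith [(hq p.1 p.2).1], (hq p.1 p.2).2⟩⟩
      bddMeas_g := fun t => ⟨hgmeas t, hgb.imp fun K hK x => by
        rw [abs_of_nonneg (hg0 t x)]; exact hK t x⟩
      nonneg_g := hg0
      step_one := hqg }
  have hh : BddMeasurable h := ⟨hhm, hhb⟩
  obtain ⟨n, rfl⟩ : ∃ n, t = s + n + 1 := ⟨t - s - 1, by omega⟩
  obtain ⟨m, rfl⟩ := Nat.exists_eq_add_of_le htT
  have hone : BddMeasurable fun _ : X => (1 : ℝ) := .const 1
  have hone_pos : ∃ δ > (0 : ℝ), ∀ _ : X, δ ≤ 1 := ⟨1, one_pos, fun _ => le_rfl⟩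
  set w := stepIter ν q g (s + n + 1) m fun _ => 1
  have hwm : BddMeasurable w := H.bddMeas_stepIter _ _ hone
  have hwpos : ∃ δ > 0, ∀ x, δ ≤ w x := H.stepIter_lower _ _ hone hone_pos
  set W := stepOp ν q g (s + n + 1) w
  have hWm : BddMeasurable W := H.bddMeas_stepOp _ hwm
  have hWpos : ∃ δ > 0, ∀ x, δ ≤ W x := H.stepIter_lower (s + n) 1 hwm hwpos
  set G := stepIter ν q g s n W
  have hGm : BddMeasurable G := H.bddMeas_stepIter _ _ hWm
  have hGpos : ∃ δ > 0, ∀ x, δ ≤ G x := H.stepIter_lower _ _ hWm hWpos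
  have hLt : ∀ x, Lop ν q g (s + n + 1) (s + n + 1 + m) x (fun _ => 1) = w x :=
    H.Lop_eq_stepIter _ _ hone
  have hLs : ∀ x, Lop ν q g s (s + n + 1 + m) x (fun _ => 1) = G x := by
    intro x
    rw [show s + n + 1 + m = s + (n + 1 + m) by ring, H.Lop_eq_stepIter _ _ hone, stepIter_add]
    rfl
  have hAG := H.unnormFilter_pos hχg0 s hGm hGpos
  have hAone := H.unnormFilter_pos hχg0 s hone hone_pos
  have hDone := H.unnormFilter_pos hχg0 (s + n) hone hone_pos
  have hzero' : unnormFilter ν χ q g s (fun x => h x * G x) = 0 := by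
    simp only [phismooth, hLs, H.philt_eq s (hh.mul hGm), H.philt_eq s hGm] at hzero
    simpa [hAG.ne', hAone.ne'] using hzero
  have hpred : phipred ν χ q g (s + n + 1)
      (fun z => g (s + n + 1) z * Lop ν q g (s + n + 1) (s + n + 1 + m) z fun _ => 1) =
      unnormFilter ν χ q g s G / unnormFilter ν χ q g (s + n) fun _ => 1 := by
    simp only [hLt]
    change philt ν χ q g (s + n) W = _
    rw [H.philt_eq _ hWm, StrongMixing.unnormFilter_add s n W]
  set F := stepIter ν q g s n fun y => q y x'
  have hFm : BddMeasurable F := H.bddMeas_stepIter _ _ (H.bddMeas_q_left x')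
  have hjoint : jointSm ν χ q g s (s + n + 1 - 1) (fun xs y => h xs * q y x') =
      unnormFilter ν χ q g s (fun x => h x * F x) /
        unnormFilter ν χ q g (s + n) fun _ => 1 := by
    have h1 := H.jointNum_eq (χ := χ) hs n hone hone
    simp only [one_mul, mul_one] at h1
    rw [jointSm, Nat.add_sub_cancel, H.jointNum_eq hs n hh (H.bddMeas_q_left x'), h1,
      StrongMixing.unnormFilter_add s n]
  obtain ⟨a, b, ha, hb, hab, hbw⟩ := H.exists_ratio_bounds (t := s + n + 1) (by omega) x' hwm hwpos
    fun x => H.stepIter_harnack _ _ _ _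
  obtain ⟨a', b', hab', ha', hb'⟩ :=
    H.stepIter_contract s n x' (H.bddMeas_q_left x') hWm hWpos ha hb
  have hcov := H.abs_unnormFilter_centred_le hχg0 s hh hFm hGm hGpos hzero' ha' hb'
  have hosc : 0 ≤ osc h := (abs_nonneg _).trans (abs_sub_le_osc hhb x' x')
  have hρ : 0 ≤ 1 - σm / σp := sub_nonneg.2 ((div_le_one hσp).2 hσmp)
  have hwx : 0 < w x' := by
    obtain ⟨δ, hδ, hwδ⟩ := hwpos
    exact hδ.trans_le (hwδ x')
  rw [hpred, hjoint, hLt, show s + n + 1 - s = n + 1 by omega]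
  set N := unnormFilter ν χ q g s fun x => h x * F x
  set A := unnormFilter ν χ q g s G
  set D := unnormFilter ν χ q g (s + n) fun _ => 1
  have hratio : N / D * w x' / (A / D) = N * w x' / A := by
    field_simp
  rw [hratio, abs_div, abs_mul, abs_of_pos hwx, abs_of_pos hAG, div_le_iff₀ hAG]
  calc |N| * w x' ≤ osc h * ((b' - a') / 2) * A * w x' :=
        mul_le_mul_of_nonneg_right hcov hwx.le
    _ = osc h * (1 - σm / σp) ^ n * A * w x' * ((b - a) / 2) := by rw [hab']; ring
    _ ≤ osc h * (1 - σm / σp) ^ n * A * w x' * ((1 - σm / σp) * b) :=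
        mul_le_mul_of_nonneg_left (by linarith) (by positivity)
    _ = osc h * (1 - σm / σp) ^ (n + 1) * A * (b * w x') := by ring
    _ ≤ osc h * (1 - σm / σp) ^ (n + 1) * A * (σp ^ 2 / (σm * cm)) :=
        mul_le_mul_of_nonneg_left hbw (by positivity)
    _ = _ := by ring
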